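/- arXiv:2112.11757 — 7 statements merged into one kernel-verified Lean document; each statement's English description precedes it below -/
import Mathlib

section
/- Let α ∈ (0,∞). For i = 1, 2 let γᵢ ∈ ℝ, σᵢ ∈ [0,∞) and let mᵢ be a Borel measure on (0,∞) with ∫ min(h², h) mᵢ(dh) < ∞, and define ψᵢ(z) = −γᵢ z + (σᵢ²/2) z² + ∫ (e^{−zh} + zh − 1) mᵢ(dh) for z ∈ [0,∞). If ψ₁(αn) = ψ₂(αn) for all n ∈ ℕ, then γ₁ = γ₂, σ₁ = σ₂ and m₁ = m₂; in particular ψ₁ = ψ₂ on [0,∞). (This says that the Laplace exponent of a spectrally positive Lévy process that does not drift to −∞ is uniquely determined by its values on the lattice αℕ.) -/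
open MeasureTheory Real Filter

/-- A finite measure on `[a, b]` is determined by its moments. -/
theorem MeasureTheory.Measure.ext_of_forall_integral_pow_eq {μ ν : Measure ℝ}
    [IsFiniteMeasure μ] [IsFiniteMeasure ν] {a b : ℝ}
    (hμ : ∀ᵐ x ∂μ, x ∈ Set.Icc a b) (hν : ∀ᵐ x ∂ν, x ∈ Set.Icc a b)
    (h : ∀ n : ℕ, ∫ x, x ^ n ∂μ = ∫ x, x ^ n ∂ν) : μ = ν := by
  have integrable_of_continuous : ∀ {ρ : Measure ℝ} [IsFiniteMeasure ρ],
      (∀ᵐ x ∂ρ, x ∈ Set.Icc a b) → ∀ {f : ℝ → ℝ}, Continuous f → Integrable f ρ := by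
    intro ρ _ hρ f hf
    obtain ⟨C, hC⟩ := (isCompact_Icc (a := a) (b := b)).exists_bound_of_continuousOn hf.continuousOn
    exact .of_bound hf.aestronglyMeasurable C (hρ.mono hC)
  have integral_eval : ∀ p : Polynomial ℝ, ∫ x, p.eval x ∂μ = ∫ x, p.eval x ∂ν := by
    intro p
    simp only [Polynomial.eval_eq_sum_range]
    rw [integral_finsetSum, integral_finsetSum]
    · simp only [integral_const_mul, h]
    · exact fun i _ => integrable_of_continuous hν (by fun_prop)
    · exact fun i _ => integrable_of_continuous hμ (by fun_prop)
  refine ext_of_forall_integral_eq_of_IsFiniteMeasure fun f => ?_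
  have dist_integral_le : ∀ {ρ : Measure ℝ} [IsFiniteMeasure ρ], (∀ᵐ x ∂ρ, x ∈ Set.Icc a b) →
      ∀ {ε : ℝ} {p : Polynomial ℝ}, (∀ x ∈ Set.Icc a b, |p.eval x - f x| < ε) →
      |∫ x, p.eval x ∂ρ - ∫ x, f x ∂ρ| ≤ ε * ρ.real Set.univ := by
    intro ρ _ hρ ε p hp
    rw [← integral_sub (integrable_of_continuous hρ p.continuous)
      (integrable_of_continuous hρ f.continuous)]
    exact norm_integral_le_of_norm_le_const (f := fun x => p.eval x - f x)
      (hρ.mono fun x hx => (hp x hx).le)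
  refine eq_of_forall_dist_le fun ε hε => ?_
  set M := μ.real Set.univ + ν.real Set.univ + 1
  have hM : 0 < M := by positivity
  obtain ⟨p, hp⟩ := exists_polynomial_near_of_continuousOn a b f f.continuous.continuousOn
    (ε / M) (by positivity)
  have h₁ := dist_integral_le hμ hp
  have h₂ := dist_integral_le hν hp
  rw [integral_eval p] at h₁
  have h₃ : ε / M * M = ε := div_mul_cancel₀ _ hM.ne'
  have h₄ : 0 < ε / M := by positivity
  have h₅ : ε / M * M = ε / M * μ.real Set.univ + ε / M * ν.real Set.univ + ε / M := by
    simp only [M]; ring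
  rw [Real.dist_eq]
  rw [abs_le] at h₁ h₂ ⊢
  constructor <;> linarith [h₁.1, h₁.2, h₂.1, h₂.2]

/-- A finite measure on `[0, ∞)` is determined by the values of its Laplace transform on
a lattice. -/
theorem MeasureTheory.Measure.ext_of_forall_integral_exp_nat_eq {μ ν : Measure ℝ}
    [IsFiniteMeasure μ] [IsFiniteMeasure ν] {α : ℝ} (hα : 0 < α)
    (hμ : ∀ᵐ x ∂μ, 0 ≤ x) (hν : ∀ᵐ x ∂ν, 0 ≤ x)
    (h : ∀ n : ℕ, ∫ x, exp (-(α * x)) ^ n ∂μ = ∫ x, exp (-(α * x)) ^ n ∂ν) : μ = ν := by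
  have hcont : Continuous fun x : ℝ => exp (-(α * x)) := by fun_prop
  have hemb : MeasurableEmbedding fun x : ℝ => exp (-(α * x)) :=
    hcont.measurableEmbedding fun x y hxy => by
      simpa [hα.ne'] using hxy
  have mem_Icc : ∀ {ρ : Measure ℝ}, (∀ᵐ x ∂ρ, 0 ≤ x) →
      ∀ᵐ y ∂ρ.map fun x => exp (-(α * x)), y ∈ Set.Icc (0 : ℝ) 1 := by
    intro ρ hρ
    rw [hemb.ae_map_iff]
    filter_upwards [hρ] with x hx
    exact ⟨(exp_pos _).le, exp_le_one_iff.2 (by nlinarith)⟩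
  rw [← hemb.comap_map μ, ← hemb.comap_map ν]
  congr 1
  refine Measure.ext_of_forall_integral_pow_eq (mem_Icc hμ) (mem_Icc hν) fun n => ?_
  rw [hemb.integral_map, hemb.integral_map]
  exact h n

theorem ae_pos_of_measure_Iic_zero {m : Measure ℝ} (hm0 : m (Set.Iic 0) = 0) :
    ∀ᵐ h ∂m, 0 < h := by
  rw [ae_iff]
  simpa [Set.Iic] using hm0

theorem integrable_exp_neg_add_sub_one {m : Measure ℝ} (hm0 : m (Set.Iic 0) = 0)
    (hm : ∫⁻ h, ENNReal.ofReal (min (h ^ 2) h) ∂m < ⊤) {z : ℝ} (hz : 0 ≤ z) :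
    Integrable (fun h => exp (-z * h) + z * h - 1) m := by
  have hpos := ae_pos_of_measure_Iic_zero hm0
  have hmin : Integrable (fun h : ℝ => min (h ^ 2) h) m := by
    refine ⟨by fun_prop, ?_⟩
    rwa [hasFiniteIntegral_iff_ofReal]
    filter_upwards [hpos] with h hh
    exact le_min (sq_nonneg h) hh.le
  refine (hmin.const_mul (z ^ 2 + z)).mono' (by fun_prop) ?_
  filter_upwards [hpos] with h hh
  have hx : 0 ≤ z * h := by positivity
  have hlow : 0 ≤ exp (-z * h) + z * h - 1 := by linarith [add_one_le_exp (-z * h)]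
  rw [Real.norm_of_nonneg hlow, mul_min_of_nonneg _ _ (by positivity)]
  refine le_min ?_ ?_
  · have hinv : exp (-z * h) * exp (z * h) = 1 := by rw [← exp_add]; simp
    have hsq : exp (-z * h) + z * h - 1 ≤ (z * h) ^ 2 := by
      nlinarith [mul_le_mul_of_nonneg_left (add_one_le_exp (z * h)) (exp_pos (-z * h)).le]
    nlinarith [mul_nonneg hz (sq_nonneg h)]
  · have : exp (-z * h) ≤ 1 := exp_le_one_iff.2 (by linarith)
    nlinarith [mul_nonneg (sq_nonneg z) hh.le]

/-- The finite measure whose Laplace transform at `z` is the second difference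
`ψ (z + 2 * α) - 2 * ψ (z + α) + ψ z` of the Laplace exponent `ψ` with volatility `σ` and
Lévy measure `m`. -/
noncomputable def secondDifferenceMeasure (α σ : ℝ) (m : Measure ℝ) : Measure ℝ :=
  m.withDensity (fun h => ENNReal.ofReal ((1 - exp (-(α * h))) ^ 2)) +
    ENNReal.ofReal (σ ^ 2 * α ^ 2) • Measure.dirac 0

section secondDifferenceMeasure

variable {α σ : ℝ} {m : Measure ℝ}

theorem one_sub_exp_sq_mul_exp_pow_eq (α h : ℝ) (n : ℕ) :
    (1 - exp (-(α * h))) ^ 2 * exp (-(α * h)) ^ n =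
      (exp (-(α * (n + 2 : ℕ)) * h) + α * (n + 2 : ℕ) * h - 1) -
      2 * (exp (-(α * (n + 1 : ℕ)) * h) + α * (n + 1 : ℕ) * h - 1) +
      (exp (-(α * n) * h) + α * n * h - 1) := by
  have hexp : ∀ k : ℕ, exp (-(α * k) * h) = exp (-(α * h)) ^ k := fun k => by
    rw [← exp_nat_mul]; ring_nf
  simp only [hexp]
  push_cast
  ring

theorem integrable_one_sub_exp_sq_mul_exp_pow (hα : 0 ≤ α) (hm0 : m (Set.Iic 0) = 0)
    (hm : ∫⁻ h, ENNReal.ofReal (min (h ^ 2) h) ∂m < ⊤) (n : ℕ) :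
    Integrable (fun h => (1 - exp (-(α * h))) ^ 2 * exp (-(α * h)) ^ n) m := by
  have hK (k : ℕ) := integrable_exp_neg_add_sub_one hm0 hm (z := α * k) (by positivity)
  simp only [one_sub_exp_sq_mul_exp_pow_eq]
  exact ((hK _).sub ((hK _).const_mul 2)).add (hK _)

theorem isFiniteMeasure_withDensity_one_sub_exp_sq (hα : 0 ≤ α) (hm0 : m (Set.Iic 0) = 0)
    (hm : ∫⁻ h, ENNReal.ofReal (min (h ^ 2) h) ∂m < ⊤) :
    IsFiniteMeasure (m.withDensity fun h => ENNReal.ofReal ((1 - exp (-(α * h))) ^ 2)) := by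
  refine isFiniteMeasure_withDensity_ofReal ?_
  simpa using (integrable_one_sub_exp_sq_mul_exp_pow hα hm0 hm 0).hasFiniteIntegral

theorem isFiniteMeasure_secondDifferenceMeasure (hα : 0 ≤ α) (hm0 : m (Set.Iic 0) = 0)
    (hm : ∫⁻ h, ENNReal.ofReal (min (h ^ 2) h) ∂m < ⊤) :
    IsFiniteMeasure (secondDifferenceMeasure α σ m) := by
  have := isFiniteMeasure_withDensity_one_sub_exp_sq hα hm0 hm
  have := (Measure.dirac (0 : ℝ)).smul_finite (ENNReal.ofReal_ne_top (r := σ ^ 2 * α ^ 2))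
  unfold secondDifferenceMeasure
  infer_instance

theorem ae_nonneg_secondDifferenceMeasure (hm0 : m (Set.Iic 0) = 0) :
    ∀ᵐ h ∂secondDifferenceMeasure α σ m, 0 ≤ h := by
  rw [secondDifferenceMeasure, ae_add_measure_iff]
  constructor
  · exact (withDensity_absolutelyContinuous _ _).ae_le
      ((ae_pos_of_measure_Iic_zero hm0).mono fun _ => le_of_lt)
  · refine Measure.ae_smul_measure ?_ _
    rw [ae_dirac_eq]
    exact le_refl (0 : ℝ)

theorem integral_exp_pow_secondDifferenceMeasure (hα : 0 ≤ α) (hm0 : m (Set.Iic 0) = 0)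
    (hm : ∫⁻ h, ENNReal.ofReal (min (h ^ 2) h) ∂m < ⊤) {γ : ℝ} {ψ : ℝ → ℝ}
    (hψ : ∀ z, 0 ≤ z → ψ z = -γ * z + σ ^ 2 / 2 * z ^ 2 +
      ∫ h, (exp (-z * h) + z * h - 1) ∂m) (n : ℕ) :
    ∫ h, exp (-(α * h)) ^ n ∂secondDifferenceMeasure α σ m =
      ψ (α * (n + 2 : ℕ)) - 2 * ψ (α * (n + 1 : ℕ)) + ψ (α * n) := by
  have hK (k : ℕ) := integrable_exp_neg_add_sub_one hm0 hm (z := α * k) (by positivity)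
  have := isFiniteMeasure_secondDifferenceMeasure (σ := σ) hα hm0 hm
  have hint : Integrable (fun h => exp (-(α * h)) ^ n) (secondDifferenceMeasure α σ m) := by
    refine .of_bound (by fun_prop) 1 ?_
    filter_upwards [ae_nonneg_secondDifferenceMeasure hm0] with h hh
    rw [Real.norm_of_nonneg (by positivity)]
    exact pow_le_one₀ (exp_pos _).le (exp_le_one_iff.2 (by nlinarith))
  have hdensity : ∫ h, exp (-(α * h)) ^ n
      ∂m.withDensity (fun h => ENNReal.ofReal ((1 - exp (-(α * h))) ^ 2)) =
      ∫ h, (1 - exp (-(α * h))) ^ 2 * exp (-(α * h)) ^ n ∂m := by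
    rw [integral_withDensity_eq_integral_toReal_smul (by fun_prop) (by simp)]
    simp [ENNReal.toReal_ofReal, sq_nonneg]
  unfold secondDifferenceMeasure at hint ⊢
  rw [integral_add_measure hint.left_of_add_measure hint.right_of_add_measure, hdensity,
    integral_smul_measure, integral_dirac, ENNReal.toReal_ofReal (by positivity)]
  simp only [one_sub_exp_sq_mul_exp_pow_eq]
  have hadd := integral_add ((hK (n + 2)).sub ((hK (n + 1)).const_mul 2)) (hK n)
  simp only [Pi.sub_apply] at hadd
  rw [hadd, integral_sub (hK _) ((hK _).const_mul 2), integral_const_mul,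
    hψ _ (by positivity), hψ _ (by positivity), hψ _ (by positivity)]
  push_cast
  simp
  ring

theorem secondDifferenceMeasure_singleton_zero (hm0 : m (Set.Iic 0) = 0) :
    secondDifferenceMeasure α σ m {0} = ENNReal.ofReal (σ ^ 2 * α ^ 2) := by
  have h0 : m {0} = 0 := measure_mono_null (by simp) hm0
  simp [secondDifferenceMeasure, withDensity_absolutelyContinuous _ _ h0]

theorem withDensity_one_sub_exp_sq_inv (hα : 0 < α) (hm0 : m (Set.Iic 0) = 0) :
    (m.withDensity fun h => ENNReal.ofReal ((1 - exp (-(α * h))) ^ 2)).withDensity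
      (fun h => (ENNReal.ofReal ((1 - exp (-(α * h))) ^ 2))⁻¹) = m := by
  refine withDensity_inv_same (by fun_prop) ?_ (by simp)
  filter_upwards [ae_pos_of_measure_Iic_zero hm0] with h hh
  have : exp (-(α * h)) < 1 := exp_lt_one_iff.2 (by nlinarith)
  have : 0 < 1 - exp (-(α * h)) := by linarith
  simp only [ne_eq, ENNReal.ofReal_eq_zero, not_le]
  positivity

/-- The volatility and the Lévy measure can be recovered from `secondDifferenceMeasure`. -/
theorem secondDifferenceMeasure_inj {σ₁ σ₂ : ℝ} {m₁ m₂ : Measure ℝ} (hα : 0 < α)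
    (hσ₁ : 0 ≤ σ₁) (hσ₂ : 0 ≤ σ₂) (hm₁0 : m₁ (Set.Iic 0) = 0) (hm₂0 : m₂ (Set.Iic 0) = 0)
    (h : secondDifferenceMeasure α σ₁ m₁ = secondDifferenceMeasure α σ₂ m₂) :
    σ₁ = σ₂ ∧ m₁ = m₂ := by
  have hσ : σ₁ = σ₂ := by
    have h0 := congrArg (· {0}) h
    simp only [secondDifferenceMeasure_singleton_zero hm₁0,
      secondDifferenceMeasure_singleton_zero hm₂0] at h0
    rw [ENNReal.ofReal_eq_ofReal_iff (by positivity) (by positivity)] at h0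
    have hsq : σ₁ ^ 2 = σ₂ ^ 2 := mul_right_cancel₀ (by positivity) h0
    rwa [pow_left_inj₀ hσ₁ hσ₂ two_ne_zero] at hsq
  subst hσ
  refine ⟨rfl, ?_⟩
  rw [← withDensity_one_sub_exp_sq_inv hα hm₁0, ← withDensity_one_sub_exp_sq_inv hα hm₂0]
  congr 1
  have := (Measure.dirac (0 : ℝ)).smul_finite (ENNReal.ofReal_ne_top (r := σ₁ ^ 2 * α ^ 2))
  ext s hs
  have hs' := congrArg (· s) h
  simp only [secondDifferenceMeasure, Measure.add_apply] at hs'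
  exact (ENNReal.add_left_inj (measure_ne_top _ s)).1 hs'

end secondDifferenceMeasure

/-- The Laplace exponent of a spectrally positive Lévy process that does not drift to `-∞`
is uniquely determined by its values on the lattice `αℕ`. -/
theorem laplace_exponent_determined_by_lattice
    (α : ℝ) (hα : 0 < α)
    (γ₁ γ₂ σ₁ σ₂ : ℝ) (hσ₁ : 0 ≤ σ₁) (hσ₂ : 0 ≤ σ₂)
    (m₁ m₂ : Measure ℝ)
    (hm₁0 : m₁ (Set.Iic 0) = 0) (hm₂0 : m₂ (Set.Iic 0) = 0)
    (hm₁ : ∫⁻ h, ENNReal.ofReal (min (h ^ 2) h) ∂m₁ < ⊤)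
    (hm₂ : ∫⁻ h, ENNReal.ofReal (min (h ^ 2) h) ∂m₂ < ⊤)
    (ψ₁ ψ₂ : ℝ → ℝ)
    (hψ₁ : ∀ z, 0 ≤ z → ψ₁ z = -γ₁ * z + σ₁ ^ 2 / 2 * z ^ 2 +
      ∫ h, (Real.exp (-z * h) + z * h - 1) ∂m₁)
    (hψ₂ : ∀ z, 0 ≤ z → ψ₂ z = -γ₂ * z + σ₂ ^ 2 / 2 * z ^ 2 +
      ∫ h, (Real.exp (-z * h) + z * h - 1) ∂m₂)
    (h : ∀ n : ℕ, ψ₁ (α * n) = ψ₂ (α * n)) :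
    γ₁ = γ₂ ∧ σ₁ = σ₂ ∧ m₁ = m₂ ∧ ∀ z, 0 ≤ z → ψ₁ z = ψ₂ z := by
  have := isFiniteMeasure_secondDifferenceMeasure (σ := σ₁) hα.le hm₁0 hm₁
  have := isFiniteMeasure_secondDifferenceMeasure (σ := σ₂) hα.le hm₂0 hm₂
  obtain ⟨rfl, rfl⟩ := secondDifferenceMeasure_inj hα hσ₁ hσ₂ hm₁0 hm₂0 <|
    Measure.ext_of_forall_integral_exp_nat_eq hα (ae_nonneg_secondDifferenceMeasure hm₁0)
      (ae_nonneg_secondDifferenceMeasure hm₂0) fun n => by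
        rw [integral_exp_pow_secondDifferenceMeasure hα.le hm₁0 hm₁ hψ₁,
          integral_exp_pow_secondDifferenceMeasure hα.le hm₂0 hm₂ hψ₂, h, h, h]
  have h1 := h 1
  rw [hψ₁ _ (by positivity), hψ₂ _ (by positivity)] at h1
  have hγ : γ₁ = γ₂ := by simpa [hα.ne'] using h1
  subst hγ
  exact ⟨rfl, rfl, rfl, fun z hz => by rw [hψ₁ z hz, hψ₂ z hz]⟩
end

section
/- Let m be a Borel measure on (0,∞) with ∫ min(h², h) m(dh) < ∞. Then for every z ∈ (0,∞), ∫ (e^{−zh} + zh − 1) m(dh) = z ∫₀^∞ (1 − e^{−zu}) m((u,∞)) du, both integrals being finite. -/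
open MeasureTheory Real

lemma exp_neg_add_sub_one_le_sq {x : ℝ} (hx : 0 ≤ x) : Real.exp (-x) + x - 1 ≤ x ^ 2 := by
  have h1 : Real.exp (-x) ≤ (1 + x)⁻¹ := by
    rw [Real.exp_neg]
    exact inv_anti₀ (by linarith) (by linarith [Real.add_one_le_exp x])
  have h2 : (1 + x)⁻¹ ≤ 1 - x + x ^ 2 := by
    rw [inv_le_iff_one_le_mul₀ (by linarith)]
    nlinarith [pow_nonneg hx 3]
  linarith

lemma integral_mul_one_sub_exp_neg_mul (z x : ℝ) :
    ∫ t in (0 : ℝ)..x, z * (1 - Real.exp (-z * t)) = Real.exp (-z * x) + z * x - 1 := by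
  have hd : ∀ t ∈ Set.uIcc 0 x, HasDerivAt (fun t => Real.exp (-z * t) + z * t)
      (z * (1 - Real.exp (-z * t))) t := by
    intro t _
    have h1 : HasDerivAt (fun t : ℝ => -z * t) (-z) t := by
      simpa using (hasDerivAt_id t).const_mul (-z)
    have h2 : HasDerivAt (fun t : ℝ => z * t) z t := by
      simpa using (hasDerivAt_id t).const_mul z
    exact (h1.exp.add h2).congr_deriv (by ring)
  rw [intervalIntegral.integral_eq_sub_of_hasDerivAt hd
    (Continuous.intervalIntegrable (by fun_prop) _ _)]
  simp

/-- For a Lévy measure `m` on `(0,∞)` with `∫ min(h²,h) m(dh) < ∞` and every `z > 0`,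
`∫ (e^{-zh} + zh - 1) m(dh) = z ∫₀^∞ (1 - e^{-zu}) m((u,∞)) du`, both integrals being finite. -/
theorem levy_integral_tail_formula
    (m : Measure ℝ) (hm0 : m (Set.Iic 0) = 0)
    (hm : ∫⁻ h, ENNReal.ofReal (min (h ^ 2) h) ∂m < ⊤)
    (z : ℝ) (hz : 0 < z) :
    Integrable (fun h => Real.exp (-z * h) + z * h - 1) m ∧
    IntegrableOn (fun u => (1 - Real.exp (-z * u)) * (m (Set.Ioi u)).toReal) (Set.Ioi 0) ∧
    ∫ h, (Real.exp (-z * h) + z * h - 1) ∂m =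
      z * ∫ u in Set.Ioi (0 : ℝ), (1 - Real.exp (-z * u)) * (m (Set.Ioi u)).toReal := by
  have hpos : ∀ᵐ h ∂m, 0 < h := by
    rw [ae_iff]
    simp only [not_lt]
    exact hm0
  have hf0 (h : ℝ) : 0 ≤ Real.exp (-z * h) + z * h - 1 := by
    linarith [Real.add_one_le_exp (-z * h)]
  have hg0 {u : ℝ} (hu : 0 < u) : 0 ≤ 1 - Real.exp (-z * u) :=
    sub_nonneg.2 (Real.exp_le_one_iff.2 (by nlinarith))
  have hmin : Integrable (fun h : ℝ => min (h ^ 2) h) m := by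
    refine ⟨(by fun_prop : Measurable fun h : ℝ => min (h ^ 2) h).aestronglyMeasurable, ?_⟩
    rwa [hasFiniteIntegral_iff_ofReal]
    filter_upwards [hpos] with h hh using le_min (sq_nonneg h) hh.le
  have hint : Integrable (fun h => Real.exp (-z * h) + z * h - 1) m := by
    refine (hmin.const_mul (z ^ 2 + z)).mono'
      (by fun_prop : Measurable fun h : ℝ => Real.exp (-z * h) + z * h - 1).aestronglyMeasurable ?_
    filter_upwards [hpos] with h hh
    rw [Real.norm_of_nonneg (hf0 h)]
    have hzh : 0 < z * h := mul_pos hz hh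
    rcases min_cases (h ^ 2) h with ⟨he, _⟩ | ⟨he, _⟩ <;> rw [he]
    · have := exp_neg_add_sub_one_le_sq hzh.le
      rw [← neg_mul] at this
      nlinarith [mul_pos hz (pow_pos hh 2)]
    · have : Real.exp (-z * h) ≤ 1 := Real.exp_le_one_iff.2 (by nlinarith)
      nlinarith [mul_pos (pow_pos hz 2) hh]
  have htail {u : ℝ} (hu : 0 < u) : m (Set.Ioi u) < ⊤ := by
    refine (measure_mono fun h (hh : u < h) => ?_).trans_lt
      (hmin.measure_ge_lt_top (lt_min (pow_pos hu 2) hu))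
    exact min_le_min (pow_le_pow_left₀ hu.le hh.le 2) hh.le
  have hG0 : 0 ≤ᵐ[volume.restrict (Set.Ioi 0)]
      fun u => (1 - Real.exp (-z * u)) * (m (Set.Ioi u)).toReal := by
    filter_upwards [ae_restrict_mem measurableSet_Ioi] with u hu
    exact mul_nonneg (hg0 hu) ENNReal.toReal_nonneg
  have hGm : Measurable fun u => (1 - Real.exp (-z * u)) * (m (Set.Ioi u)).toReal := by
    have hanti : Antitone fun u => m (Set.Ioi u) :=
      fun _ _ hab => measure_mono (Set.Ioi_subset_Ioi hab)
    exact (by fun_prop : Measurable fun u : ℝ => 1 - Real.exp (-z * u)).mul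
      hanti.measurable.ennreal_toReal
  have key : ∫⁻ h, ENNReal.ofReal (Real.exp (-z * h) + z * h - 1) ∂m =
      ∫⁻ u in Set.Ioi 0,
        ENNReal.ofReal (z * ((1 - Real.exp (-z * u)) * (m (Set.Ioi u)).toReal)) := by
    have hlc := lintegral_comp_eq_lintegral_meas_lt_mul m (f := fun h => h)
      (g := fun t => z * (1 - Real.exp (-z * t)))
      (by filter_upwards [hpos] with h hh using hh.le) aemeasurable_id
      (fun t _ => Continuous.intervalIntegrable (by fun_prop) _ _)
      (by filter_upwards [ae_restrict_mem measurableSet_Ioi] with u hu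
          exact mul_nonneg hz.le (hg0 hu))
    simp only [integral_mul_one_sub_exp_neg_mul] at hlc
    rw [hlc]
    refine setLIntegral_congr_fun measurableSet_Ioi fun u hu => ?_
    change m (Set.Ioi u) * _ = _
    rw [← mul_assoc, ENNReal.ofReal_mul (mul_nonneg hz.le (hg0 hu)),
      ENNReal.ofReal_toReal (htail hu).ne, mul_comm]
  have hzG0 : 0 ≤ᵐ[volume.restrict (Set.Ioi 0)]
      fun u => z * ((1 - Real.exp (-z * u)) * (m (Set.Ioi u)).toReal) := by
    filter_upwards [hG0] with u hu using mul_nonneg hz.le hu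
  have hzG : Integrable (fun u => z * ((1 - Real.exp (-z * u)) * (m (Set.Ioi u)).toReal))
      (volume.restrict (Set.Ioi 0)) := by
    refine ⟨(hGm.const_mul z).aestronglyMeasurable, ?_⟩
    rw [hasFiniteIntegral_iff_ofReal hzG0, ← key]
    exact (hasFiniteIntegral_iff_ofReal (Filter.Eventually.of_forall hf0)).1 hint.2
  refine ⟨hint, (integrable_const_mul_iff hz.ne'.isUnit _).1 hzG, ?_⟩
  rw [← integral_const_mul, integral_eq_lintegral_of_nonneg_ae hzG0 hzG.1, ← key,
    integral_eq_lintegral_of_nonneg_ae (Filter.Eventually.of_forall hf0) hint.1]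
end

section
/- Let γ ∈ ℝ and let m be a Borel measure on (0,∞) with ∫ min(h², h) m(dh) < ∞, and write M(u) := m((u,∞)) for u ∈ (0,∞). Then: (i) ∫_h^∞ M(u) du < ∞ for every h ∈ (0,∞); (ii) ∫₀^∞ u M(u) du restricted to u ∈ (0,1] is finite, so that the following integrals converge absolutely; and (iii) for every z ∈ (0,∞), −γz + z ∫₀^∞ (1 − e^{−zu}) M(u) du = z² ∫₀^∞ e^{−zh} ( ∫_h^∞ M(u) du − γ ) dh. -/
open MeasureTheory Real

/-- The layer-cake formula for the weight `min u 1`. -/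
lemma integrableOn_min_mul_tail
    (m : Measure ℝ) (hm0 : m (Set.Iic 0) = 0)
    (hm : ∫⁻ h, ENNReal.ofReal (min (h ^ 2) h) ∂m < ⊤) :
    IntegrableOn (fun u => min u 1 * (m (Set.Ioi u)).toReal) (Set.Ioi 0) := by
  have hpos : ∀ᵐ h ∂m, 0 < h := by
    rw [ae_iff]
    simpa [Set.Iic, not_lt] using hm0
  have hcont : Continuous fun u : ℝ => min u 1 := by fun_prop
  have hcake := lintegral_comp_eq_lintegral_meas_lt_mul m (f := fun h : ℝ => h)
    (g := fun u => min u 1) (hpos.mono fun h hh => hh.le) aemeasurable_id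
    (fun t _ => hcont.intervalIntegrable 0 t)
    ((ae_restrict_iff' measurableSet_Ioi).2 (.of_forall fun u hu =>
      le_min (Set.mem_Ioi.1 hu).le zero_le_one))
  have hbound : ∫⁻ h, ENNReal.ofReal (∫ u in (0 : ℝ)..h, min u 1) ∂m < ⊤ := by
    refine lt_of_le_of_lt (lintegral_mono_ae ?_) hm
    filter_upwards [hpos] with h hh
    refine ENNReal.ofReal_le_ofReal ?_
    have hle : ∫ u in (0 : ℝ)..h, min u 1 ≤ ∫ _ in (0 : ℝ)..h, min h 1 :=
      intervalIntegral.integral_mono_on hh.le (hcont.intervalIntegrable 0 h)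
        intervalIntegrable_const fun u hu => min_le_min_right 1 hu.2
    rw [intervalIntegral.integral_const, sub_zero, smul_eq_mul,
      mul_min_of_nonneg _ _ hh.le, mul_one, ← sq] at hle
    exact hle
  rw [hcake] at hbound
  have hanti : Antitone fun u : ℝ => m (Set.Ioi u) :=
    fun a b hab => measure_mono (Set.Ioi_subset_Ioi hab)
  refine ⟨(hcont.measurable.mul hanti.measurable.ennreal_toReal).aestronglyMeasurable, ?_⟩
  refine lt_of_le_of_lt (setLIntegral_mono' measurableSet_Ioi fun u hu => ?_) hbound
  have hu1 : 0 ≤ min u 1 := le_min (Set.mem_Ioi.1 hu).le zero_le_one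
  rw [Real.enorm_of_nonneg (mul_nonneg hu1 ENNReal.toReal_nonneg), ENNReal.ofReal_mul hu1,
    mul_comm]
  exact mul_le_mul_left ENNReal.ofReal_toReal_le _

lemma one_sub_exp_neg_mul_le (z : ℝ) {u : ℝ} (hu : 0 < u) :
    1 - exp (-z * u) ≤ max z 1 * min u 1 := by
  rcases le_total u 1 with h | h
  · rw [min_eq_left h]
    have h1 := add_one_le_exp (-z * u)
    have h2 := mul_le_mul_of_nonneg_right (le_max_left z 1) hu.le
    linarith
  · rw [min_eq_right h]
    have h1 := exp_pos (-z * u)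
    have h2 := le_max_right z 1
    linarith

lemma setIntegral_indicator_Iio_exp {z u : ℝ} (hz : 0 < z) (hu : 0 < u) :
    ∫ h in Set.Ioi (0 : ℝ), (Set.Iio u).indicator (fun h => exp (-z * h)) h =
      (1 - exp (-z * u)) / z := by
  rw [setIntegral_indicator measurableSet_Iio, Set.Ioi_inter_Iio,
    ← integral_Ioc_eq_integral_Ioo, ← intervalIntegral.integral_of_le hu.le,
    intervalIntegral.integral_comp_mul_left _ (neg_ne_zero.2 hz.ne'), integral_exp]
  simp only [mul_zero, exp_zero, smul_eq_mul]
  field_simp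
  ring

/-- Fubini for the kernel `exp (-z h) M u` on `{0 < h < u}`. -/
lemma integrable_and_integral_exp_mul_tail {M : ℝ → ℝ} (hMm : Measurable M)
    (hM0 : ∀ u, 0 ≤ M u) {z : ℝ} (hz : 0 < z)
    (hint : IntegrableOn (fun u => (1 - exp (-z * u)) * M u) (Set.Ioi 0)) :
    IntegrableOn (fun h => exp (-z * h) * ∫ u in Set.Ioi h, M u) (Set.Ioi 0) ∧
    ∫ h in Set.Ioi (0 : ℝ), exp (-z * h) * ∫ u in Set.Ioi h, M u =
      (∫ u in Set.Ioi (0 : ℝ), (1 - exp (-z * u)) * M u) / z := by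
  set ν : Measure ℝ := volume.restrict (Set.Ioi 0) with hν
  set F : ℝ → ℝ → ℝ := fun h u => (Set.Iio u).indicator (fun h => exp (-z * h)) h * M u with hF
  have hF0 : ∀ h u, 0 ≤ F h u := fun h u =>
    mul_nonneg (Set.indicator_nonneg (fun _ _ => (exp_pos _).le) _) (hM0 u)
  have hFm : Measurable (Function.uncurry F) := by
    have : Function.uncurry F = fun p : ℝ × ℝ =>
        {p : ℝ × ℝ | p.1 < p.2}.indicator (fun p => exp (-z * p.1)) p * M p.2 := by
      ext ⟨h, u⟩
      simp [F, Set.indicator, Function.uncurry]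
    rw [this]
    exact ((by fun_prop : Measurable fun p : ℝ × ℝ => exp (-z * p.1)).indicator
      (measurableSet_lt measurable_fst measurable_snd)).mul (hMm.comp measurable_snd)
  have hexp : Integrable (fun h => exp (-z * h)) ν :=
    integrableOn_exp_mul_Ioi (neg_neg_of_pos hz) 0
  have hinner : ∀ᵐ u ∂ν, ∫ h, F h u ∂ν = (1 - exp (-z * u)) * M u / z := by
    refine (ae_restrict_iff' measurableSet_Ioi).2 (.of_forall fun u hu => ?_)
    simp only [F]
    rw [integral_mul_const, setIntegral_indicator_Iio_exp hz hu]
    ring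
  have houter : ∀ᵐ h ∂ν, ∫ u, F h u ∂ν = exp (-z * h) * ∫ u in Set.Ioi h, M u := by
    refine (ae_restrict_iff' measurableSet_Ioi).2 (.of_forall fun h hh => ?_)
    have : ∀ u, F h u = (Set.Ioi h).indicator (fun u => exp (-z * h) * M u) u := fun u => by
      by_cases hu : h < u <;> simp [F, hu]
    simp only [this]
    rw [setIntegral_indicator measurableSet_Ioi, Set.Ioi_inter_Ioi,
      sup_eq_right.2 (Set.mem_Ioi.1 hh).le, integral_const_mul]
  have hFint : Integrable (Function.uncurry F) (ν.prod ν) := by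
    rw [integrable_prod_iff' hFm.aestronglyMeasurable]
    refine ⟨.of_forall fun u => (hexp.indicator measurableSet_Iio).mul_const (M u), ?_⟩
    refine (hint.div_const z).congr ?_
    filter_upwards [hinner] with u hu
    simp only [Function.uncurry_apply_pair, norm_of_nonneg (hF0 _ _), hu]
  refine ⟨hFint.integral_prod_left.congr houter, ?_⟩
  rw [← integral_congr_ae houter, integral_integral_swap hFint, integral_congr_ae hinner,
    integral_div]

/-- For a Lévy measure `m` on `(0,∞)` with tail `M(u) = m((u,∞))`:
(i) `∫_h^∞ M(u) du < ∞` for every `h > 0`; (ii) `u ↦ u·M(u)` is integrable on `(0,1]`;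
(iii) for every `z > 0`,
`-γz + z ∫₀^∞ (1 - e^{-zu}) M(u) du = z² ∫₀^∞ e^{-zh} (∫_h^∞ M(u) du - γ) dh`. -/
theorem levy_tail_double_integral
    (γ : ℝ) (m : Measure ℝ) (hm0 : m (Set.Iic 0) = 0)
    (hm : ∫⁻ h, ENNReal.ofReal (min (h ^ 2) h) ∂m < ⊤)
    (M : ℝ → ℝ) (hM : ∀ u, M u = (m (Set.Ioi u)).toReal) :
    (∀ h : ℝ, 0 < h → IntegrableOn M (Set.Ioi h)) ∧
    IntegrableOn (fun u => u * M u) (Set.Ioc 0 1) ∧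
    ∀ z : ℝ, 0 < z →
      -γ * z + z * ∫ u in Set.Ioi (0 : ℝ), (1 - Real.exp (-z * u)) * M u =
      z ^ 2 * ∫ h in Set.Ioi (0 : ℝ), Real.exp (-z * h) * ((∫ u in Set.Ioi h, M u) - γ) := by
  have hmin := integrableOn_min_mul_tail m hm0 hm
  simp only [← hM] at hmin
  have hM0 : ∀ u, 0 ≤ M u := fun u => hM u ▸ ENNReal.toReal_nonneg
  have hMm : Measurable M := by
    have hanti : Antitone fun u : ℝ => m (Set.Ioi u) :=
      fun a b hab => measure_mono (Set.Ioi_subset_Ioi hab)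
    rw [funext hM]
    exact hanti.measurable.ennreal_toReal
  refine ⟨fun h hh => ?_, ?_, fun z hz => ?_⟩
  · have hh1 : 0 < min h 1 := lt_min hh one_pos
    refine ((hmin.mono_set (Set.Ioi_subset_Ioi hh.le)).const_mul (min h 1)⁻¹).mono'
      hMm.aestronglyMeasurable
      ((ae_restrict_iff' measurableSet_Ioi).2 (.of_forall fun u hu => ?_))
    rw [norm_of_nonneg (hM0 u), le_inv_mul_iff₀ hh1]
    exact mul_le_mul_of_nonneg_right (min_le_min_right 1 (Set.mem_Ioi.1 hu).le) (hM0 u)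
  · refine (hmin.mono_set Set.Ioc_subset_Ioi_self).congr_fun (fun u hu => ?_) measurableSet_Ioc
    simp only [min_eq_left hu.2]
  · have hint : IntegrableOn (fun u => (1 - exp (-z * u)) * M u) (Set.Ioi 0) := by
      refine (hmin.const_mul (max z 1)).mono'
        (by fun_prop : Measurable fun u => (1 - exp (-z * u)) * M u).aestronglyMeasurable
        ((ae_restrict_iff' measurableSet_Ioi).2 (.of_forall fun u hu => ?_))
      have hu0 : 0 < u := hu
      have hexp : exp (-z * u) ≤ 1 := exp_le_one_iff.2 (by nlinarith [mul_pos hz hu0])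
      rw [norm_of_nonneg (mul_nonneg (sub_nonneg.2 hexp) (hM0 u)), ← mul_assoc]
      exact mul_le_mul_of_nonneg_right (one_sub_exp_neg_mul_le z hu0) (hM0 u)
    obtain ⟨htail, heq⟩ := integrable_and_integral_exp_mul_tail hMm hM0 hz hint
    have hexp : IntegrableOn (fun h => exp (-z * h)) (Set.Ioi 0) :=
      integrableOn_exp_mul_Ioi (neg_neg_of_pos hz) 0
    simp only [mul_sub]
    rw [integral_sub htail (hexp.mul_const γ), heq, integral_mul_const,
      integral_exp_mul_Ioi (neg_neg_of_pos hz) 0]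
    simp only [mul_zero, exp_zero]
    field_simp
    ring
end

section
/- Let α, s ∈ (0,∞), t ∈ [0,∞), c, C ∈ (0,∞), and let (a_k)_{k ∈ ℕ₀} be a sequence in (0,∞) satisfying c^k/(k!)² ≤ a_k ≤ C^k/k! for all k ∈ ℕ₀. Then for every λ with 0 ≤ λ < c/(C s^α + t), the double series ∑_{n=0}^∞ (λ^n/n!) ∑_{k=0}^n (a_{n−k}/a_n) s^{α(n−k)} t^k/k! is bounded above by ∑_{n=0}^∞ ((C s^α + t) λ / c)^n, and in particular is finite. -/
open Real

/-- A lower bound on `a n` and an upper bound on `a (n - k)` bound the `k`-th inner summand by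
a multiple of the `k`-th binomial term of `(t + C * s ^ α) ^ n`. -/
theorem inner_summand_le {α s t c C : ℝ} (hs : 0 < s) (ht : 0 ≤ t) (hc : 0 < c) (hC : 0 < C)
    {a : ℕ → ℝ} {n k : ℕ} (hk : k ≤ n)
    (hlow : c ^ n / (n.factorial : ℝ) ^ 2 ≤ a n)
    (hupp : a (n - k) ≤ C ^ (n - k) / ((n - k).factorial : ℝ)) :
    a (n - k) / a n * s ^ (α * ((n - k : ℕ) : ℝ)) * t ^ k / (k.factorial : ℝ) ≤
      (n.factorial : ℝ) / c ^ n * (t ^ k * (C * s ^ α) ^ (n - k) * (n.choose k : ℝ)) := by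
  have hratio : a (n - k) / a n ≤
      C ^ (n - k) / ((n - k).factorial : ℝ) / (c ^ n / (n.factorial : ℝ) ^ 2) :=
    div_le_div₀ (by positivity) hupp (by positivity) hlow
  calc a (n - k) / a n * s ^ (α * ((n - k : ℕ) : ℝ)) * t ^ k / (k.factorial : ℝ)
      ≤ C ^ (n - k) / ((n - k).factorial : ℝ) / (c ^ n / (n.factorial : ℝ) ^ 2) *
          s ^ (α * ((n - k : ℕ) : ℝ)) * t ^ k / (k.factorial : ℝ) := by gcongr
    _ = _ := by
      rw [Real.rpow_mul_natCast hs.le, Nat.cast_choose ℝ hk, mul_pow]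
      field_simp

/-- Each term of the outer series is at most the corresponding term of the geometric series. -/
theorem outer_term_le {α s t c C : ℝ} (hs : 0 < s) (ht : 0 ≤ t) (hc : 0 < c) (hC : 0 < C)
    {a : ℕ → ℝ}
    (hab : ∀ k : ℕ, c ^ k / ((k.factorial : ℝ)) ^ 2 ≤ a k ∧ a k ≤ C ^ k / (k.factorial : ℝ))
    {lam : ℝ} (hlam0 : 0 ≤ lam) (n : ℕ) :
    lam ^ n / (n.factorial : ℝ) *
        ∑ k ∈ Finset.range (n + 1),
          a (n - k) / a n * s ^ (α * ((n - k : ℕ) : ℝ)) * t ^ k / (k.factorial : ℝ) ≤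
      ((C * s ^ α + t) * lam / c) ^ n := by
  calc _ ≤ lam ^ n / (n.factorial : ℝ) * ∑ k ∈ Finset.range (n + 1),
          (n.factorial : ℝ) / c ^ n * (t ^ k * (C * s ^ α) ^ (n - k) * (n.choose k : ℝ)) := by
        gcongr with k hk
        exact inner_summand_le hs ht hc hC (Nat.lt_succ_iff.mp (Finset.mem_range.mp hk))
          (hab n).1 (hab (n - k)).2
    _ = _ := by
      rw [← Finset.mul_sum, ← add_pow, add_comm t, div_pow, mul_pow]
      field_simp

/-- Under the bounds `c^k/(k!)² ≤ a_k ≤ C^k/k!`, for `0 ≤ λ < c/(C s^α + t)` the double series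
`∑_n (λ^n/n!) ∑_{k=0}^n (a_{n-k}/a_n) s^{α(n-k)} t^k/k!` is dominated by the geometric series
`∑_n ((C s^α + t) λ / c)^n`, and in particular is finite. -/
theorem double_series_bound
    (α s t c C : ℝ) (hα : 0 < α) (hs : 0 < s) (ht : 0 ≤ t) (hc : 0 < c) (hC : 0 < C)
    (a : ℕ → ℝ) (ha : ∀ k, 0 < a k)
    (hab : ∀ k : ℕ, c ^ k / ((k.factorial : ℝ)) ^ 2 ≤ a k ∧ a k ≤ C ^ k / (k.factorial : ℝ))
    (lam : ℝ) (hlam0 : 0 ≤ lam) (hlam : lam < c / (C * s ^ α + t)) :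
    (∑' n : ℕ, ENNReal.ofReal (lam ^ n / (n.factorial : ℝ) *
        ∑ k ∈ Finset.range (n + 1),
          a (n - k) / a n * s ^ (α * ((n - k : ℕ) : ℝ)) * t ^ k / (k.factorial : ℝ))) ≤
      (∑' n : ℕ, ENNReal.ofReal (((C * s ^ α + t) * lam / c) ^ n)) ∧
    (∑' n : ℕ, ENNReal.ofReal (lam ^ n / (n.factorial : ℝ) *
        ∑ k ∈ Finset.range (n + 1),
          a (n - k) / a n * s ^ (α * ((n - k : ℕ) : ℝ)) * t ^ k / (k.factorial : ℝ))) < ⊤ := by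
  have hy : 0 < C * s ^ α + t := by positivity
  have hle := ENNReal.tsum_le_tsum fun n =>
    ENNReal.ofReal_le_ofReal (outer_term_le (α := α) hs ht hc hC hab hlam0 n)
  have hr0 : 0 ≤ (C * s ^ α + t) * lam / c := by positivity
  have hr1 : (C * s ^ α + t) * lam / c < 1 := by
    rw [div_lt_one hc, mul_comm]
    exact (lt_div_iff₀ hy).mp hlam
  exact ⟨hle, hle.trans_lt (summable_geometric_of_lt_one hr0 hr1).tsum_ofReal_lt_top⟩
end

section
/- Let z₀ ∈ [0,∞), θ ∈ (z₀,∞), and let g : [z₀,∞) → [0,∞) be continuously differentiable with g(z₀) = 0, g > 0 on (z₀,∞), lim_{z→∞} g(z) = ∞ and ∫_θ^∞ dz/g(z) = ∞. Define G(z) := ∫_θ^z dw/g(w) for z ∈ (z₀,∞) (so G(z) ∈ [−∞,∞), with G(z) → −∞ as z ↓ z₀). Then for every x ∈ (0,∞) and q ∈ (0,∞), the integrals ∫_{z₀}^∞ (q/g(z)) exp(−xz + qG(z)) dz and x ∫_{z₀}^∞ exp(−xz + qG(z)) dz are both finite and equal. (This shows that the two expressions for the first-passage Laplace transform of a continuous-state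 branching process that does not hit 0 coincide.) -/
open MeasureTheory Real

open Set Filter Topology

/-- A primitive `∫_θ^z 1/g` of the reciprocal of a positive continuous function on `(a, ∞)` has
derivative `1/g` there. -/
theorem hasDerivAt_of_eq_integral_inv {a θ : ℝ} (hθ : a < θ) {g G : ℝ → ℝ}
    (hg : ContinuousOn g (Ioi a)) (hgpos : ∀ z, a < z → 0 < g z)
    (hG : ∀ z, a < z → G z = ∫ w in θ..z, (g w)⁻¹) {z : ℝ} (hz : a < z) :
    HasDerivAt G (g z)⁻¹ z := by
  have hcont : ContinuousOn (fun w => (g w)⁻¹) (Ioi a) :=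
    hg.inv₀ fun w hw => (hgpos w hw).ne'
  have hint : IntervalIntegrable (fun w => (g w)⁻¹) volume θ z :=
    (hcont.mono fun w hw => (lt_min hθ hz).trans_le hw.1).intervalIntegrable
  exact (intervalIntegral.integral_hasDerivAt_right hint
    (hcont.stronglyMeasurableAtFilter isOpen_Ioi z hz)
    (hcont.continuousAt (Ioi_mem_nhds hz))).congr_of_eventuallyEq
    (eventually_of_mem (Ioi_mem_nhds hz) hG)

/-- If `G' = 1/g` on `(a, ∞)` with `g > 0` at most linear near `a`, then `G → -∞` at `a`. -/
theorem tendsto_atBot_of_hasDerivAt_inv {a : ℝ} {g G : ℝ → ℝ}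
    (hgpos : ∀ z, a < z → 0 < g z)
    (hgO : g =O[𝓝[>] a] fun z => z - a)
    (hG : ∀ z, a < z → HasDerivAt G (g z)⁻¹ z) :
    Tendsto G (𝓝[>] a) atBot := by
  obtain ⟨L, hL, hbound⟩ := hgO.exists_pos
  obtain ⟨b, hb, hsub⟩ := mem_nhdsGT_iff_exists_Ioo_subset.1 hbound.bound
  have hlin : ∀ z ∈ Ioo a b, g z ≤ L * (z - a) := fun z hz => by
    have h := hsub hz
    simp only [mem_ofPred_eq, Real.norm_eq_abs, abs_of_pos (hgpos z hz.1),
      abs_of_pos (sub_pos.2 hz.1)] at h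
    exact h
  have hderiv : ∀ z ∈ Ioo a b,
      HasDerivAt (fun z => L * G z - Real.log (z - a)) (L * (g z)⁻¹ - 1 / (z - a)) z :=
    fun z hz => ((hG z hz.1).const_mul L).sub
      (((hasDerivAt_id z).sub_const a).log (sub_pos.2 hz.1).ne')
  have hmono : MonotoneOn (fun z => L * G z - Real.log (z - a)) (Ioo a b) := by
    refine monotoneOn_of_hasDerivWithinAt_nonneg (convex_Ioo a b)
      (fun z hz => (hderiv z hz).continuousAt.continuousWithinAt)
      (f' := fun z => L * (g z)⁻¹ - 1 / (z - a))
      (fun z hz => (hderiv z (interior_subset hz)).hasDerivWithinAt) fun z hz => ?_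
    have hz' := interior_subset hz
    have := sub_pos.2 hz'.1
    rw [sub_nonneg, ← div_eq_mul_inv, div_le_div_iff₀ this (hgpos z hz'.1), one_mul]
    exact hlin z hz'
  obtain ⟨c, hc⟩ := nonempty_Ioo.2 (mem_Ioi.1 hb)
  have hlog : Tendsto (fun z => Real.log (z - a)) (𝓝[>] a) atBot := by
    refine tendsto_log_nhdsGT_zero.comp (tendsto_nhdsWithin_iff.2 ⟨?_, ?_⟩)
    · have : Tendsto (fun z => z - a) (𝓝 a) (𝓝 (a - a)) := tendsto_id.sub_const a
      rw [sub_self] at this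
      exact this.mono_left nhdsWithin_le_nhds
    · filter_upwards [self_mem_nhdsWithin] with z hz using sub_pos.2 (mem_Ioi.1 hz)
  refine tendsto_atBot_mono' _ ?_
    ((tendsto_atBot_add_const_right _ (L * G c - Real.log (c - a)) hlog).const_mul_atBot
      (inv_pos.2 hL))
  filter_upwards [Ioo_mem_nhdsGT hc.1] with z hz
  have h := hmono ⟨hz.1, hz.2.trans hc.2⟩ hc hz.2.le
  simp only at h
  rw [inv_mul_eq_div, le_div_iff₀ hL]
  linarith

/-- If `G' = 1/g` with `g → ∞`, then `e^{-xz + qG(z)}` decays exponentially at infinity. -/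
theorem exists_exp_decay {a : ℝ} {g G : ℝ → ℝ}
    (hgtop : Tendsto g atTop atTop) (hG : ∀ z, a < z → HasDerivAt G (g z)⁻¹ z)
    {x q : ℝ} (hx : 0 < x) :
    ∃ M > a, ∃ C : ℝ, ∀ z ≥ M, q / g z ≤ x / 2 ∧
      Real.exp (-x * z + q * G z) ≤ C * Real.exp (-(x / 2) * z) := by
  have hsmall : ∀ᶠ z in atTop, q / g z ≤ x / 2 :=
    (hgtop.const_div_atTop q).eventually_le_const (half_pos hx)
  obtain ⟨N, hN⟩ := eventually_atTop.1 hsmall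
  have haM : a < max N (a + 1) := (lt_add_one a).trans_le (le_max_right _ _)
  have hNM : N ≤ max N (a + 1) := le_max_left _ _
  generalize max N (a + 1) = M at haM hNM
  have hderiv : ∀ z ∈ Ici M,
      HasDerivAt (fun z => q * G z - x / 2 * z) (q * (g z)⁻¹ - x / 2) z := fun z hz => by
    have h := ((hG z (haM.trans_le hz)).const_mul q).sub ((hasDerivAt_id z).const_mul (x / 2))
    rw [mul_one] at h
    exact h
  have hanti : AntitoneOn (fun z => q * G z - x / 2 * z) (Ici M) := by
    refine antitoneOn_of_hasDerivWithinAt_nonpos (convex_Ici M)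
      (fun z hz => (hderiv z hz).continuousAt.continuousWithinAt)
      (f' := fun z => q * (g z)⁻¹ - x / 2)
      (fun z hz => (hderiv z (interior_subset hz)).hasDerivWithinAt) fun z hz => ?_
    rw [← div_eq_mul_inv, sub_nonpos]
    exact hN z (hNM.trans (interior_subset hz))
  refine ⟨M, haM, Real.exp (q * G M - x / 2 * M), fun z hz => ⟨hN z (hNM.trans hz), ?_⟩⟩
  rw [← Real.exp_add, Real.exp_le_exp]
  have h := hanti self_mem_Ici hz hz
  simp only at h
  linarith

/-- For a branching-mechanism-type function `g` (C¹ on `[z₀,∞)`, vanishing exactly at `z₀`,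
tending to `∞`, with `∫_θ^∞ 1/g = ∞`) and `G(z) = ∫_θ^z 1/g`, the two integrals
`∫_{z₀}^∞ (q/g(z)) e^{-xz + qG(z)} dz` and `x ∫_{z₀}^∞ e^{-xz + qG(z)} dz`
are both finite and equal, for every `x, q ∈ (0,∞)`. -/
theorem csbp_scale_function_identity
    (z₀ θ : ℝ) (hz₀ : 0 ≤ z₀) (hθ : z₀ < θ) (g : ℝ → ℝ)
    (hg : ContDiffOn ℝ 1 g (Set.Ici z₀))
    (hg0 : g z₀ = 0)
    (hgnonneg : ∀ z, z₀ ≤ z → 0 ≤ g z)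
    (hgpos : ∀ z, z₀ < z → 0 < g z)
    (hgtop : Filter.Tendsto g Filter.atTop Filter.atTop)
    (hgint : ∫⁻ z in Set.Ioi θ, ENNReal.ofReal (1 / g z) = ⊤)
    (G : ℝ → ℝ) (hG : ∀ z, z₀ < z → G z = ∫ w in θ..z, (g w)⁻¹)
    (x q : ℝ) (hx : 0 < x) (hq : 0 < q) :
    IntegrableOn (fun z => q / g z * Real.exp (-x * z + q * G z)) (Set.Ioi z₀) ∧
    IntegrableOn (fun z => Real.exp (-x * z + q * G z)) (Set.Ioi z₀) ∧
    ∫ z in Set.Ioi z₀, q / g z * Real.exp (-x * z + q * G z) =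
      x * ∫ z in Set.Ioi z₀, Real.exp (-x * z + q * G z) := by
  have hgcont : ContinuousOn g (Ioi z₀) := hg.continuousOn.mono Ioi_subset_Ici_self
  have hGderiv : ∀ z, z₀ < z → HasDerivAt G (g z)⁻¹ z := fun z hz =>
    hasDerivAt_of_eq_integral_inv hθ hgcont hgpos hG hz
  have hGcont : ContinuousOn G (Ioi z₀) := fun z hz =>
    (hGderiv z hz).continuousAt.continuousWithinAt
  have hgO : g =O[𝓝[>] z₀] fun z => z - z₀ := by
    have h := (hg.differentiableOn one_ne_zero z₀ self_mem_Ici).hasFDerivWithinAt.isBigO_sub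
    simp only [hg0, sub_zero] at h
    exact h.mono (nhdsWithin_mono _ Ioi_subset_Ici_self)
  have hGbot := tendsto_atBot_of_hasDerivAt_inv hgpos hgO hGderiv
  have hE0 : Tendsto (fun z => Real.exp (q * G z)) (𝓝[>] z₀) (𝓝 0) :=
    tendsto_exp_atBot.comp (hGbot.const_mul_atBot hq)
  obtain ⟨M, hM, C, hdecay⟩ := exists_exp_decay (q := q) hgtop hGderiv hx
  have hFcont : ContinuousOn (fun z => Real.exp (-x * z + q * G z)) (Ioi z₀) := by fun_prop
  have hqFcont : ContinuousOn (fun z => q / g z * Real.exp (-x * z + q * G z)) (Ioi z₀) :=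
    (continuousOn_const.div hgcont fun z hz => (hgpos z hz).ne').mul hFcont
  have hEcont : ContinuousOn (Function.update (fun z => Real.exp (q * G z)) z₀ 0) (Icc z₀ M) := by
    intro z hz
    rcases hz.1.eq_or_lt with rfl | hlt
    · refine continuousWithinAt_update_same.2 (hE0.mono_left (nhdsWithin_mono _ ?_))
      exact fun w hw => lt_of_le_of_ne hw.1.1 (Ne.symm hw.2)
    · rw [continuousWithinAt_update_of_ne hlt.ne']
      exact ((hGderiv z hlt).const_mul q).exp.continuousAt.continuousWithinAt
  have hEle : ∀ z, z₀ < z → Real.exp (-x * z + q * G z) ≤ Real.exp (q * G z) := fun z hz =>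
    Real.exp_le_exp.2 (by nlinarith [mul_pos hx (hz₀.trans_lt hz)])
  have hEint : IntegrableOn (fun z => Real.exp (q * G z)) (Ioc z₀ M) :=
    ((hEcont.integrableOn_Icc).mono_set Ioc_subset_Icc_self).congr_fun
      (fun z hz => Function.update_of_ne hz.1.ne' _ _) measurableSet_Ioc
  have hE'int : IntegrableOn (fun z => Real.exp (q * G z) * (q * (g z)⁻¹)) (Ioc z₀ M) := by
    refine intervalIntegral.integrableOn_deriv_of_nonneg hEcont (fun z hz => ?_) fun z hz => ?_
    · refine ((hGderiv z hz.1).const_mul q).exp.congr_of_eventuallyEq ?_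
      filter_upwards [Ioi_mem_nhds hz.1] with w hw using Function.update_of_ne (ne_of_gt hw) _ _
    · have := hgpos z hz.1
      positivity
  have hFint_tail : IntegrableOn (fun z => Real.exp (-x * z + q * G z)) (Ioi M) := by
    refine ((exp_neg_integrableOn_Ioi M (half_pos hx)).const_mul C).mono'
      ((hFcont.mono (Ioi_subset_Ioi hM.le)).aestronglyMeasurable measurableSet_Ioi) ?_
    refine (ae_restrict_iff' measurableSet_Ioi).2 (ae_of_all _ fun z hz => ?_)
    rw [Real.norm_eq_abs, Real.abs_exp]
    exact (hdecay z (le_of_lt hz)).2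
  have hFint : IntegrableOn (fun z => Real.exp (-x * z + q * G z)) (Ioi z₀) := by
    rw [← Ioc_union_Ioi_eq_Ioi hM.le]
    refine IntegrableOn.union (hEint.mono'
      ((hFcont.mono Ioc_subset_Ioi_self).aestronglyMeasurable measurableSet_Ioc) ?_) hFint_tail
    refine (ae_restrict_iff' measurableSet_Ioc).2 (ae_of_all _ fun z hz => ?_)
    rw [Real.norm_eq_abs, Real.abs_exp]
    exact hEle z hz.1
  have hqFint : IntegrableOn (fun z => q / g z * Real.exp (-x * z + q * G z)) (Ioi z₀) := by
    have hnorm : ∀ z, z₀ < z → ‖q / g z * Real.exp (-x * z + q * G z)‖ =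
        q / g z * Real.exp (-x * z + q * G z) := fun z hz => by
      have := hgpos z hz
      exact Real.norm_of_nonneg (by positivity)
    rw [← Ioc_union_Ioi_eq_Ioi hM.le]
    refine IntegrableOn.union (hE'int.mono'
      ((hqFcont.mono Ioc_subset_Ioi_self).aestronglyMeasurable measurableSet_Ioc) ?_)
      ((hFint_tail.const_mul (x / 2)).mono'
        ((hqFcont.mono (Ioi_subset_Ioi hM.le)).aestronglyMeasurable measurableSet_Ioi) ?_)
    · refine (ae_restrict_iff' measurableSet_Ioc).2 (ae_of_all _ fun z hz => ?_)
      rw [hnorm z hz.1, mul_comm, div_eq_mul_inv]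
      have := hgpos z hz.1
      exact mul_le_mul_of_nonneg_right (hEle z hz.1) (by positivity)
    · refine (ae_restrict_iff' measurableSet_Ioi).2 (ae_of_all _ fun z hz => ?_)
      rw [hnorm z (hM.trans hz)]
      exact mul_le_mul_of_nonneg_right (hdecay z (le_of_lt hz)).1 (Real.exp_pos _).le
  refine ⟨hqFint, hFint, ?_⟩
  have hF0 : Tendsto (fun z => Real.exp (-x * z + q * G z)) (𝓝[>] z₀) (𝓝 0) :=
    tendsto_of_tendsto_of_tendsto_of_le_of_le' tendsto_const_nhds hE0
      (Eventually.of_forall fun z => (Real.exp_pos _).le)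
      (eventually_of_mem self_mem_nhdsWithin hEle)
  have hFtop : Tendsto (fun z => Real.exp (-x * z + q * G z)) atTop (𝓝 0) := by
    have h : Tendsto (fun z => C * Real.exp (-(x / 2) * z)) atTop (𝓝 (C * 0)) :=
      (tendsto_exp_atBot.comp
        (tendsto_id.const_mul_atTop_of_neg (neg_neg_of_pos (half_pos hx)))).const_mul C
    rw [mul_zero] at h
    exact tendsto_of_tendsto_of_tendsto_of_le_of_le' tendsto_const_nhds h
      (Eventually.of_forall fun z => (Real.exp_pos _).le)
      (eventually_atTop.2 ⟨M, fun z hz => (hdecay z hz).2⟩)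
  have hderiv : ∀ z ∈ Ioi z₀,
      HasDerivAt (Function.update (fun z => Real.exp (-x * z + q * G z)) z₀ 0)
        (q / g z * Real.exp (-x * z + q * G z) - x * Real.exp (-x * z + q * G z)) z := by
    intro z hz
    have h := (((hasDerivAt_id z).const_mul (-x)).add ((hGderiv z hz).const_mul q)).exp
    refine (h.congr_of_eventuallyEq ?_).congr_deriv ?_
    · filter_upwards [Ioi_mem_nhds hz] with w hw using Function.update_of_ne (ne_of_gt hw) _ _
    · simp only [Pi.add_apply, id]
      ring
  have hfund := integral_Ioi_of_hasDerivAt_of_tendsto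
    (continuousWithinAt_update_same.2 (by rwa [Ici_sdiff_left])) hderiv
    (hqFint.sub (hFint.const_mul x))
    (hFtop.congr' (by
      filter_upwards [eventually_gt_atTop z₀] with z hz
      rw [Function.update_of_ne hz.ne']))
  rw [Function.update_self, sub_zero, integral_sub hqFint (hFint.const_mul x),
    integral_const_mul] at hfund
  exact sub_eq_zero.1 hfund
end

section
/- Let z₀ ∈ [0,∞), θ ∈ (z₀,∞), and let g : [z₀,∞) → [0,∞) be continuously differentiable with g(z₀) = 0, g > 0 on (z₀,∞), lim_{z→∞} g(z) = ∞ and ∫_θ^∞ dz/g(z) = ∞. For q ∈ (0,∞) define Φ_q(x) := x ∫_{z₀}^∞ e^{−xz} exp( q ∫_θ^z dw/g(w) ) dz for x ∈ (0,∞). Then Φ_q is finite-valued, continuous and strictly decreasing on (0,∞), with lim_{x↓0} Φ_q(x) = ∞ and lim_{x→∞} Φ_q(x) = 0; in particular Φ_q is a bijection of (0,∞) onto (0,∞). -/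
open MeasureTheory Real

open Filter Topology in
/-- If `k` is continuous, is monotone, vanishes at `0`, tends to `∞` and is strictly
increasing beyond `z₀`, the normalised Laplace transform `x ↦ ∫ e^{-u} k(u / x) du` is a decreasing
bijection of `(0,∞)`. -/
theorem normalized_laplace_bijection {k : ℝ → ℝ} {z₀ : ℝ} (hkc : Continuous k)
    (hkm : Monotone k) (hk0 : k 0 = 0) (hks : StrictMonoOn k (Set.Ici z₀))
    (hktop : Tendsto k atTop atTop)
    (hki : ∀ x, 0 < x → IntegrableOn (fun u => exp (-u) * k (u / x)) (Set.Ioi 0))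
    {Φ : ℝ → ℝ} (hΦ : ∀ x, 0 < x → Φ x = ∫ u in Set.Ioi 0, exp (-u) * k (u / x)) :
    ContinuousOn Φ (Set.Ioi 0) ∧
    StrictAntiOn Φ (Set.Ioi 0) ∧
    Tendsto Φ (𝓝[Set.Ioi 0] 0) atTop ∧
    Tendsto Φ atTop (𝓝 0) ∧
    Set.BijOn Φ (Set.Ioi 0) (Set.Ioi 0) := by
  have hknn : ∀ u, 0 ≤ u → 0 ≤ k u := fun u hu => hk0 ▸ hkm hu
  have hmeas : ∀ x, AEStronglyMeasurable (fun u => exp (-u) * k (u / x))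
      (volume.restrict (Set.Ioi 0)) := fun x =>
    Continuous.aestronglyMeasurable (by fun_prop)
  have hbound : ∀ a x : ℝ, 0 < a → a ≤ x → ∀ᵐ u ∂(volume.restrict (Set.Ioi (0 : ℝ))),
      ‖exp (-u) * k (u / x)‖ ≤ exp (-u) * k (u / a) := by
    intro a x ha hax
    filter_upwards [ae_restrict_mem measurableSet_Ioi] with u hu
    have hu : 0 < u := hu
    have hx : 0 < x := ha.trans_le hax
    rw [norm_of_nonneg (mul_nonneg (exp_pos _).le (hknn _ (by positivity)))]
    exact mul_le_mul_of_nonneg_left (hkm (by gcongr)) (exp_pos _).le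
  have hcont : ContinuousOn Φ (Set.Ioi 0) := by
    refine ContinuousOn.congr (f := fun x => ∫ u in Set.Ioi 0, exp (-u) * k (u / x)) ?_
      (fun x hx => hΦ x hx)
    intro x hx
    have hx : 0 < x := hx
    refine ContinuousAt.continuousWithinAt ?_
    refine continuousAt_of_dominated (bound := fun u => exp (-u) * k (u / (x / 2)))
      (Eventually.of_forall hmeas) ?_ (hki _ (by positivity)) ?_
    · filter_upwards [lt_mem_nhds (half_lt_self hx)] with y hy
      exact hbound _ _ (by positivity) hy.le
    · refine Eventually.of_forall fun u => ?_
      exact continuousAt_const.mul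
        (hkc.continuousAt.comp (continuousAt_const.div continuousAt_id hx.ne'))
  have hanti : StrictAntiOn Φ (Set.Ioi 0) := by
    intro x hx y hy hxy
    have hx : 0 < x := hx
    have hy : 0 < y := hy
    rw [hΦ x hx, hΦ y hy, ← sub_pos, ← integral_sub (hki x hx) (hki y hy)]
    refine (integral_pos_iff_support_of_nonneg_ae ?_ ((hki x hx).sub (hki y hy))).2 ?_
    · filter_upwards [hbound x y hx hxy.le] with u hu
      exact sub_nonneg.2 ((le_abs_self _).trans hu)
    · have hsub : Set.Ioi (max 0 (y * z₀)) ⊆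
          Function.support fun u => exp (-u) * k (u / x) - exp (-u) * k (u / y) := by
        intro u hu
        obtain ⟨hu0, hu1⟩ := max_lt_iff.1 (Set.mem_Ioi.1 hu)
        have hlt : u / y < u / x := div_lt_div_of_pos_left hu0 hx hxy
        have hz : z₀ < u / y := by rw [lt_div_iff₀ hy]; linarith
        exact (sub_pos.2 (mul_lt_mul_of_pos_left (hks hz.le (hz.trans hlt).le hlt)
          (exp_pos _))).ne'
      refine lt_of_lt_of_le ?_ (measure_mono hsub)
      rw [Measure.restrict_apply measurableSet_Ioi, Set.inter_eq_left.2
        (Set.Ioi_subset_Ioi (le_max_left _ _)), volume_Ioi]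
      exact ENNReal.zero_lt_top
  have htop : Tendsto Φ (𝓝[Set.Ioi 0] 0) atTop := by
    have hlim : Tendsto (fun x : ℝ => exp (-1) * k x⁻¹) (𝓝[Set.Ioi 0] 0) atTop :=
      (hktop.comp tendsto_inv_nhdsGT_zero).const_mul_atTop (exp_pos _)
    refine tendsto_atTop_mono' _ ?_ hlim
    filter_upwards [self_mem_nhdsWithin] with x hx
    have hx : 0 < x := hx
    rw [hΦ x hx]
    calc exp (-1) * k x⁻¹ = ∫ u in Set.Ioi (1 : ℝ), exp (-u) * k x⁻¹ := by
          rw [integral_mul_const, integral_exp_neg_Ioi]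
      _ ≤ ∫ u in Set.Ioi (1 : ℝ), exp (-u) * k (u / x) := by
          refine setIntegral_mono_on ((integrableOn_exp_neg_Ioi 1).mul_const _)
            ((hki x hx).mono_set (Set.Ioi_subset_Ioi zero_le_one)) measurableSet_Ioi ?_
          intro u hu
          have hu : 1 < u := hu
          refine mul_le_mul_of_nonneg_left (hkm ?_) (exp_pos _).le
          rw [inv_eq_one_div]
          gcongr
      _ ≤ _ := by
          refine setIntegral_mono_set (hki x hx) ?_
            (Set.Ioi_subset_Ioi zero_le_one).eventuallyLE
          filter_upwards [ae_restrict_mem measurableSet_Ioi] with u hu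
          have hu : 0 < u := hu
          exact mul_nonneg (exp_pos _).le (hknn _ (by positivity))
  have hzero : Tendsto Φ atTop (𝓝 0) := by
    have hlim : Tendsto (fun x => ∫ u in Set.Ioi (0 : ℝ), exp (-u) * k (u / x)) atTop
        (𝓝 (∫ _ in Set.Ioi (0 : ℝ), (0 : ℝ))) := by
      refine tendsto_integral_filter_of_dominated_convergence
        (fun u => exp (-u) * k (u / 1)) (Eventually.of_forall hmeas) ?_ (hki 1 one_pos) ?_
      · filter_upwards [eventually_ge_atTop 1] with x hx
        exact hbound 1 x one_pos hx
      · refine Eventually.of_forall fun u => ?_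
        have hdiv : Tendsto (fun x : ℝ => u / x) atTop (𝓝 0) :=
          tendsto_const_nhds.div_atTop tendsto_id
        have := ((hkc.tendsto 0).comp hdiv).const_mul (exp (-u))
        rwa [hk0, mul_zero] at this
    rw [integral_zero] at hlim
    refine hlim.congr' ?_
    filter_upwards [eventually_gt_atTop 0] with x hx
    exact (hΦ x hx).symm
  refine ⟨hcont, hanti, htop, hzero, ?_, hanti.injOn, ?_⟩
  · intro x hx
    have hx : 0 < x := hx
    have hx1 : 0 < x + 1 := by positivity
    refine lt_of_le_of_lt ?_ (hanti hx hx1 (lt_add_one x))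
    rw [hΦ _ hx1]
    refine setIntegral_nonneg measurableSet_Ioi fun u hu => ?_
    have hu : 0 < u := hu
    exact mul_nonneg (exp_pos _).le (hknn _ (by positivity))
  · exact isPreconnected_Ioi.intermediate_value_Ioi
      (le_principal_iff.2 (Ioi_mem_atTop 0)) (le_principal_iff.2 self_mem_nhdsWithin)
      hcont hzero htop

/-- The primitive of `1 / g` on `(z₀,∞)`. -/
theorem hasDerivAt_integral_inv {z₀ θ : ℝ} (hθ : z₀ < θ) {g : ℝ → ℝ}
    (hg : ContinuousOn g (Set.Ioi z₀)) (hgpos : ∀ z, z₀ < z → 0 < g z) {z : ℝ} (hz : z₀ < z) :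
    HasDerivAt (fun z => ∫ w in θ..z, (g w)⁻¹) (g z)⁻¹ z := by
  have hinv : ContinuousOn (fun w => (g w)⁻¹) (Set.Ioi z₀) :=
    hg.inv₀ fun w hw => (hgpos w hw).ne'
  refine intervalIntegral.integral_hasDerivAt_right ?_
    (hinv.stronglyMeasurableAtFilter isOpen_Ioi z hz) (hinv.continuousAt (Ioi_mem_nhds hz))
  refine (hinv.mono ?_).intervalIntegrable
  intro w hw
  exact (lt_min hθ hz).trans_le hw.1

open Filter Topology in
/-- Divergence of `∫ 1 / g` at infinity. -/
theorem tendsto_integral_inv_atTop {z₀ θ : ℝ} (hθ : z₀ < θ) {g : ℝ → ℝ}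
    (hg : ContinuousOn g (Set.Ioi z₀)) (hgpos : ∀ z, z₀ < z → 0 < g z)
    (hmono : MonotoneOn (fun z => ∫ w in θ..z, (g w)⁻¹) (Set.Ioi z₀))
    (hgint : ∫⁻ z in Set.Ioi θ, ENNReal.ofReal (1 / g z) = ⊤) :
    Tendsto (fun z => ∫ w in θ..z, (g w)⁻¹) atTop atTop := by
  have hinv : ContinuousOn (fun w => (g w)⁻¹) (Set.Ioi z₀) :=
    hg.inv₀ fun w hw => (hgpos w hw).ne'
  by_contra hnot
  obtain ⟨B, hB⟩ : ∃ B, ∀ z, z₀ < z → ∫ w in θ..z, (g w)⁻¹ ≤ B := by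
    by_contra! hunb
    refine hnot (tendsto_atTop.2 fun B => ?_)
    obtain ⟨z, hz, hBz⟩ := hunb B
    filter_upwards [eventually_ge_atTop z] with y hy
    exact hBz.le.trans (hmono hz (hz.trans_le hy) hy)
  have hint : IntegrableOn (fun w => (g w)⁻¹) (Set.Ioi θ) := by
    refine integrableOn_Ioi_of_intervalIntegral_norm_bounded (l := atTop) (b := id) B θ ?_
      tendsto_id ?_
    · intro z
      refine ((hinv.mono fun w hw => hθ.trans_le hw.1).integrableOn_Icc).mono_set
        Set.Ioc_subset_Icc_self
    · filter_upwards [eventually_ge_atTop θ] with z hz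
      refine le_of_eq_of_le (intervalIntegral.integral_congr fun w hw => ?_)
        (hB z (hθ.trans_le hz))
      rw [id, Set.uIcc_of_le hz] at hw
      exact norm_of_nonneg (inv_nonneg.2 (hgpos w (hθ.trans_le hw.1)).le)
  have := hint.lintegral_lt_top
  simp only [one_div] at hgint
  exact this.ne hgint

open Filter Topology in
/-- Divergence of `∫ 1 / g` at a zero where `g` is differentiable from the right. -/
theorem tendsto_integral_inv_nhdsGT {z₀ θ : ℝ} (hθ : z₀ < θ) {g : ℝ → ℝ}
    (hg : ContinuousOn g (Set.Ioi z₀)) (hgd : DifferentiableWithinAt ℝ g (Set.Ici z₀) z₀)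
    (hg0 : g z₀ = 0) (hgpos : ∀ z, z₀ < z → 0 < g z) :
    Tendsto (fun z => ∫ w in θ..z, (g w)⁻¹) (𝓝[>] z₀) atBot := by
  obtain ⟨C, hC, hO⟩ := hgd.isBigO_sub.exists_pos
  rw [Asymptotics.isBigOWith_iff] at hO
  obtain ⟨c, hc, hcO⟩ := (mem_nhdsGE_iff_exists_Ico_subset).1 hO
  have hc : z₀ < c := hc
  set b := (z₀ + c) / 2 with hb
  have hb0 : z₀ < b := by linarith
  have hle : ∀ w, z₀ < w → w ≤ b → g w ≤ C * (w - z₀) := by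
    intro w hw hwb
    have : ‖g w - g z₀‖ ≤ C * ‖w - z₀‖ := hcO ⟨hw.le, by linarith⟩
    rwa [hg0, sub_zero, norm_of_nonneg (hgpos w hw).le, norm_of_nonneg (by linarith)] at this
  set G := fun z => (∫ w in θ..z, (g w)⁻¹) - C⁻¹ * log (z - z₀) with hG
  have hder : ∀ z, z₀ < z → HasDerivAt G ((g z)⁻¹ - C⁻¹ * (1 / (z - z₀))) z := by
    intro z hz
    refine (hasDerivAt_integral_inv hθ hg hgpos hz).sub (HasDerivAt.const_mul _ ?_)
    exact ((hasDerivAt_id z).sub_const z₀).log (sub_pos.2 hz).ne'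
  have hmono : MonotoneOn G (Set.Ioc z₀ b) := by
    refine monotoneOn_of_deriv_nonneg (convex_Ioc _ _)
      (fun z hz => (hder z hz.1).continuousAt.continuousWithinAt) ?_ ?_
    · intro z hz
      rw [interior_Ioc] at hz
      exact (hder z hz.1).differentiableAt.differentiableWithinAt
    · intro z hz
      rw [interior_Ioc] at hz
      rw [(hder z hz.1).deriv, one_div, ← mul_inv, sub_nonneg]
      exact inv_anti₀ (hgpos z hz.1) (hle z hz.1 hz.2.le)
  have hlog : Tendsto (fun z => G b + C⁻¹ * log (z - z₀)) (𝓝[>] z₀) atBot := by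
    refine tendsto_atBot_add_const_left _ _ (Tendsto.const_mul_atBot (inv_pos.2 hC) ?_)
    refine tendsto_log_nhdsGT_zero.comp ?_
    refine tendsto_nhdsWithin_iff.2 ⟨?_, ?_⟩
    · have : Tendsto (fun z => z - z₀) (𝓝 z₀) (𝓝 (z₀ - z₀)) := by
        exact (continuous_id.sub continuous_const).tendsto z₀
      rw [sub_self] at this
      exact this.mono_left nhdsWithin_le_nhds
    · filter_upwards [self_mem_nhdsWithin] with z hz
      exact sub_pos.2 (Set.mem_Ioi.1 hz)
  refine tendsto_atBot_mono' _ ?_ hlog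
  filter_upwards [Ioc_mem_nhdsGT hb0] with z hz
  have := hmono hz ⟨hb0, le_rfl⟩ hz.2
  have hGz : G z = (∫ w in θ..z, (g w)⁻¹) - C⁻¹ * log (z - z₀) := rfl
  linarith

open Filter Topology in
/-- If `g → ∞`, a primitive of `1 / g` grows at most linearly with arbitrarily small slope. -/
theorem exists_integral_inv_le {z₀ θ : ℝ} (hθ : z₀ < θ) {g : ℝ → ℝ}
    (hg : ContinuousOn g (Set.Ioi z₀)) (hgpos : ∀ z, z₀ < z → 0 < g z)
    (hgtop : Tendsto g atTop atTop)
    (hmono : MonotoneOn (fun z => ∫ w in θ..z, (g w)⁻¹) (Set.Ioi z₀)) {ε : ℝ} (hε : 0 < ε) :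
    ∃ B, ∀ z, z₀ < z → ∫ w in θ..z, (g w)⁻¹ ≤ B + ε * (z - z₀) := by
  obtain ⟨M, hM⟩ := eventually_atTop.1 (hgtop.eventually_ge_atTop ε⁻¹)
  set N := max M θ with hN
  have hN0 : z₀ < N := hθ.trans_le (le_max_right _ _)
  have hder : ∀ z, z₀ < z →
      HasDerivAt (fun z => (∫ w in θ..z, (g w)⁻¹) - ε * z) ((g z)⁻¹ - ε * 1) z := fun z hz =>
    (hasDerivAt_integral_inv hθ hg hgpos hz).sub ((hasDerivAt_id z).const_mul ε)
  have hanti : AntitoneOn (fun z => (∫ w in θ..z, (g w)⁻¹) - ε * z) (Set.Ici N) := by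
    refine antitoneOn_of_deriv_nonpos (convex_Ici _)
      (fun z hz => (hder z (hN0.trans_le hz)).continuousAt.continuousWithinAt) ?_ ?_
    · intro z hz
      rw [interior_Ici] at hz
      exact (hder z (hN0.trans hz)).differentiableAt.differentiableWithinAt
    · intro z hz
      rw [interior_Ici] at hz
      rw [(hder z (hN0.trans hz)).deriv, mul_one, sub_nonpos]
      exact inv_le_of_inv_le₀ hε (hM z ((le_max_left _ _).trans (le_of_lt hz)))
  refine ⟨∫ w in θ..N, (g w)⁻¹, fun z hz => ?_⟩
  rcases le_total z N with h | h
  · have h1 := hmono hz hN0 h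
    have h2 := mul_pos hε (sub_pos.2 hz)
    simp only at h1
    linarith
  · have h1 := hanti Set.self_mem_Ici h h
    have h2 := mul_pos hε (sub_pos.2 hN0)
    simp only at h1
    linarith

/-- For a branching-mechanism-type function `g` (C¹ on `[z₀,∞)`, vanishing exactly at `z₀`,
tending to `∞`, with `∫_θ^∞ 1/g = ∞`), the scale function
`Φ_q(x) = x ∫_{z₀}^∞ e^{-xz} exp(q ∫_θ^z 1/g) dz` is finite-valued, continuous and strictly
decreasing on `(0,∞)`, tends to `∞` at `0+` and to `0` at `∞`; in particular it is a
bijection of `(0,∞)` onto `(0,∞)`. -/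
theorem csbp_scale_bijection
    (z₀ θ : ℝ) (hz₀ : 0 ≤ z₀) (hθ : z₀ < θ) (g : ℝ → ℝ)
    (hg : ContDiffOn ℝ 1 g (Set.Ici z₀))
    (hg0 : g z₀ = 0)
    (hgnonneg : ∀ z, z₀ ≤ z → 0 ≤ g z)
    (hgpos : ∀ z, z₀ < z → 0 < g z)
    (hgtop : Filter.Tendsto g Filter.atTop Filter.atTop)
    (hgint : ∫⁻ z in Set.Ioi θ, ENNReal.ofReal (1 / g z) = ⊤)
    (q : ℝ) (hq : 0 < q)
    (Φ : ℝ → ℝ)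
    (hΦ : ∀ x, Φ x = x * ∫ z in Set.Ioi z₀,
      Real.exp (-x * z) * Real.exp (q * ∫ w in θ..z, (g w)⁻¹)) :
    (∀ x, 0 < x → IntegrableOn
      (fun z => Real.exp (-x * z) * Real.exp (q * ∫ w in θ..z, (g w)⁻¹)) (Set.Ioi z₀)) ∧
    ContinuousOn Φ (Set.Ioi 0) ∧
    StrictAntiOn Φ (Set.Ioi 0) ∧
    Filter.Tendsto Φ (nhdsWithin 0 (Set.Ioi 0)) Filter.atTop ∧
    Filter.Tendsto Φ Filter.atTop (nhds 0) ∧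
    Set.BijOn Φ (Set.Ioi 0) (Set.Ioi 0) := by
  have hgc : ContinuousOn g (Set.Ioi z₀) := hg.continuousOn.mono Set.Ioi_subset_Ici_self
  have hder : ∀ z, z₀ < z → HasDerivAt (fun z => ∫ w in θ..z, (g w)⁻¹) (g z)⁻¹ z :=
    fun z hz => hasDerivAt_integral_inv hθ hgc hgpos hz
  have hstrict : StrictMonoOn (fun z => ∫ w in θ..z, (g w)⁻¹) (Set.Ioi z₀) := by
    refine strictMonoOn_of_deriv_pos (convex_Ioi _)
      (fun z hz => (hder z hz).continuousAt.continuousWithinAt) fun z hz => ?_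
    rw [interior_Ioi] at hz
    rw [(hder z hz).deriv]
    exact inv_pos.2 (hgpos z hz)
  have htop := tendsto_integral_inv_atTop hθ hgc hgpos hstrict.monotoneOn hgint
  have hbot := tendsto_integral_inv_nhdsGT hθ hgc
    (hg.differentiableOn one_ne_zero z₀ Set.self_mem_Ici) hg0 hgpos
  have hlin := fun {ε : ℝ} (hε : 0 < ε) =>
    exists_integral_inv_le hθ hgc hgpos hgtop hstrict.monotoneOn hε
  set F : ℝ → ℝ := fun z => ∫ w in θ..z, (g w)⁻¹ with hF
  have hint : ∀ x, 0 < x →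
      IntegrableOn (fun z => exp (-x * z) * exp (q * F z)) (Set.Ioi z₀) := by
    intro x hx
    obtain ⟨B, hB⟩ := hlin (ε := x / (2 * q)) (by positivity)
    have hdom : IntegrableOn (fun z => exp (q * B) * exp (-(x / 2) * z)) (Set.Ioi z₀) :=
      (integrableOn_exp_mul_Ioi (by linarith) z₀).const_mul _
    refine Integrable.mono' hdom (ContinuousOn.aestronglyMeasurable (fun z hz => ?_)
      measurableSet_Ioi) ?_
    · have hFc : ContinuousAt F z := (hder z hz).continuousAt
      exact ContinuousAt.continuousWithinAt (by fun_prop)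
    · filter_upwards [ae_restrict_mem measurableSet_Ioi] with z hz
      rw [norm_of_nonneg (by positivity), ← exp_add, ← exp_add, exp_le_exp]
      have h1 := mul_le_mul_of_nonneg_left (hB z hz) hq.le
      have h2 : q * (B + x / (2 * q) * (z - z₀)) = q * B + x / 2 * (z - z₀) := by
        field_simp
      rw [h2] at h1
      have h3 : 0 ≤ x / 2 * z₀ := by positivity
      change -x * z + q * F z ≤ _
      linarith
  set k : ℝ → ℝ := (Set.Ioi z₀).indicator fun z => exp (q * F z) with hk
  have hk_of_lt : ∀ {z}, z₀ < z → k z = exp (q * F z) := fun hz =>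
    Set.indicator_of_mem (Set.mem_Ioi.2 hz) _
  have hk_of_le : ∀ {z}, z ≤ z₀ → k z = 0 := fun hz =>
    Set.indicator_of_notMem (Set.notMem_Ioi.2 hz) _
  have hknn : ∀ z, 0 ≤ k z := Set.indicator_nonneg fun z _ => (exp_pos _).le
  have hks : StrictMonoOn k (Set.Ici z₀) := by
    intro a ha b hb hab
    have ha : z₀ ≤ a := ha
    rw [hk_of_lt (ha.trans_lt hab)]
    rcases ha.eq_or_lt with rfl | ha
    · rw [hk_of_le le_rfl]
      exact exp_pos _
    · rw [hk_of_lt ha, exp_lt_exp]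
      exact mul_lt_mul_of_pos_left (hstrict ha (ha.trans hab) hab) hq
  have hkm : Monotone k := by
    intro a b hab
    rcases le_total a z₀ with h | h
    · rw [hk_of_le h]
      exact hknn b
    · exact hks.monotoneOn h (h.trans hab) hab
  have hkc : Continuous k := by
    refine continuous_iff_continuousAt.2 fun z => ?_
    rcases lt_trichotomy z z₀ with hz | rfl | hz
    · refine (continuousAt_const (y := (0 : ℝ))).congr ?_
      filter_upwards [Iio_mem_nhds hz] with y hy
      exact (hk_of_le (le_of_lt hy)).symm
    · refine continuousAt_iff_continuous_left'_right'.2 ⟨?_, ?_⟩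
      · refine (continuousWithinAt_const (b := (0 : ℝ))).congr (fun y hy => ?_) (hk_of_le le_rfl)
        exact hk_of_le (le_of_lt hy)
      · rw [ContinuousWithinAt, hk_of_le le_rfl]
        refine (tendsto_exp_atBot.comp (hbot.const_mul_atBot hq)).congr' ?_
        filter_upwards [self_mem_nhdsWithin] with y hy
        exact (hk_of_lt hy).symm
    · have hFc : ContinuousAt F z := (hder z hz).continuousAt
      refine ContinuousAt.congr (f := fun y => exp (q * F y)) (by fun_prop) ?_
      filter_upwards [Ioi_mem_nhds hz] with y hy
      exact (hk_of_lt hy).symm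
  have hktop : Filter.Tendsto k Filter.atTop Filter.atTop := by
    refine (tendsto_exp_atTop.comp (htop.const_mul_atTop hq)).congr' ?_
    filter_upwards [Filter.eventually_gt_atTop z₀] with z hz
    exact (hk_of_lt hz).symm
  have hind : ∀ x : ℝ, (fun z => exp (-x * z) * k z) =
      (Set.Ioi z₀).indicator fun z => exp (-x * z) * exp (q * F z) := by
    intro x
    ext z
    exact (Set.indicator_mul_right _ (fun z => exp (-x * z)) _).symm
  have hscale : ∀ x : ℝ, 0 < x →
      (fun z => exp (-(x * z)) * k (x * z / x)) = fun z => exp (-x * z) * k z := by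
    intro x hx
    ext z
    rw [mul_div_cancel_left₀ _ hx.ne', neg_mul]
  refine ⟨hint, normalized_laplace_bijection hkc hkm (hk_of_le hz₀) hks hktop ?_ ?_⟩
  · intro x hx
    rw [← mul_zero x, ← integrableOn_Ioi_comp_mul_left_iff _ _ hx, hscale x hx, hind,
      IntegrableOn, integrable_indicator_iff measurableSet_Ioi]
    exact (hint x hx).mono_measure Measure.restrict_le_self
  · intro x hx
    have hsub := integral_comp_mul_left_Ioi (fun u => exp (-u) * k (u / x)) 0 hx
    rw [mul_zero, hscale x hx, hind, setIntegral_indicator measurableSet_Ioi,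
      Set.inter_eq_right.2 (Set.Ioi_subset_Ioi hz₀)] at hsub
    rw [hΦ x]
    change x * (∫ z in Set.Ioi z₀, exp (-x * z) * exp (q * F z)) = _
    rw [hsub, smul_eq_mul, mul_inv_cancel_left₀ hx.ne']
end

section
/- Let f : [0,∞) → ℝ be càdlàg (right-continuous with left limits) and suppose f has no negative jumps, i.e. f(t−) ≤ f(t) for every t ∈ (0,∞). Then the running infimum t ↦ inf { f(s) : s ∈ [0,t] } is a continuous (and nonincreasing) function on [0,∞). -/
open Set Filter

/-- A real function that is right-continuous and has left limits on `[0,∞)` is bounded below on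
compact intervals. -/
lemma bddBelow_image_Icc_of_cadlag {f : ℝ → ℝ}
    (hrc : ∀ t ∈ Ici (0 : ℝ), ContinuousWithinAt f (Ici t) t)
    (hll : ∀ t ∈ Ioi (0 : ℝ), ∃ L : ℝ, Tendsto f (nhdsWithin t (Ico 0 t)) (nhds L)) (t : ℝ) :
    BddBelow (f '' Icc 0 t) := by
  refine isCompact_Icc.induction_on (p := fun s => BddBelow (f '' s)) (by simp)
    (fun s u hsu hu => hu.mono (image_mono hsu))
    (fun s u hs hu => by rw [image_union]; exact hs.union hu) fun x hx => ?_
  obtain ⟨c, hc⟩ : ∃ c, ∀ᶠ y in nhdsWithin x (Ico 0 x), c < f y := by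
    rcases hx.1.eq_or_lt with rfl | h
    · exact ⟨0, by simp⟩
    · obtain ⟨L, hL⟩ := hll x h
      exact ⟨L - 1, hL.eventually_const_lt (by linarith)⟩
  have hd : ∀ᶠ y in nhdsWithin x (Ici x), f x - 1 < f y :=
    (hrc x hx.1).eventually_const_lt (by linarith)
  refine ⟨{y | min c (f x - 1) < f y}, ?_, min c (f x - 1), ?_⟩
  · have hsub : Icc 0 t ⊆ Ico 0 x ∪ Ici x := fun y hy =>
      (lt_or_ge y x).imp (fun h => ⟨hy.1, h⟩) id
    refine nhdsWithin_mono x hsub ?_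
    rw [nhdsWithin_union]
    exact mem_sup.2 ⟨hc.mono fun y hy => (min_le_left _ _).trans_lt hy,
      hd.mono fun y hy => (min_le_right _ _).trans_lt hy⟩
  · rintro _ ⟨y, hy, rfl⟩
    exact le_of_lt hy

/-- If `f : [0,∞) → ℝ` is càdlàg (right-continuous with left limits) with no negative jumps
(`f(t-) ≤ f(t)` for all `t > 0`), then the running infimum
`t ↦ inf { f(s) : s ∈ [0,t] }` is continuous and nonincreasing on `[0,∞)`. -/
theorem running_infimum_continuous_of_no_negative_jumps
    (f : ℝ → ℝ)
    (hrc : ∀ t ∈ Set.Ici (0 : ℝ), ContinuousWithinAt f (Set.Ici t) t)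
    (hll : ∀ t ∈ Set.Ioi (0 : ℝ), ∃ L : ℝ,
      Filter.Tendsto f (nhdsWithin t (Set.Ico 0 t)) (nhds L) ∧ L ≤ f t)
    (m : ℝ → ℝ) (hm : ∀ t, m t = sInf (f '' Set.Icc 0 t)) :
    ContinuousOn m (Set.Ici 0) ∧ AntitoneOn m (Set.Ici 0) := by
  have hbdd := bddBelow_image_Icc_of_cadlag hrc fun t ht => (hll t ht).imp fun _ h => h.1
  have hle : ∀ {s t : ℝ}, 0 ≤ s → s ≤ t → m t ≤ f s := fun {s t} hs hst => by
    rw [hm]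
    exact csInf_le (hbdd t) ⟨s, ⟨hs, hst⟩, rfl⟩
  have hge : ∀ {t c : ℝ}, 0 ≤ t → (∀ u, 0 ≤ u → u ≤ t → c ≤ f u) → c ≤ m t := by
    intro t c ht h
    rw [hm]
    refine le_csInf ((nonempty_Icc.2 ht).image f) ?_
    rintro _ ⟨u, hu, rfl⟩
    exact h u hu.1 hu.2
  have hanti : AntitoneOn m (Ici 0) := fun s hs t ht hst =>
    hge hs fun u hu hus => hle hu (hus.trans hst)
  refine ⟨fun t ht => ?_, hanti⟩
  have ht0 : 0 ≤ t := ht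
  have hsub : Ici 0 ⊆ Ico 0 t ∪ Ici t := fun y hy => (lt_or_ge y t).imp (fun h => ⟨hy, h⟩) id
  refine ContinuousWithinAt.mono (ContinuousWithinAt.union ?_ ?_) hsub
  · rcases ht0.eq_or_lt with rfl | htpos
    · simp [ContinuousWithinAt]
    obtain ⟨L, hL, hLt⟩ := hll t htpos
    refine Metric.continuousWithinAt_iff.2 fun ε hε => ?_
    obtain ⟨δ, hδ, h⟩ := Metric.tendsto_nhdsWithin_nhds.1 hL (ε / 3) (by positivity)
    refine ⟨δ, hδ, fun s hs hst => ?_⟩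
    have hfs := abs_lt.1 (h hs hst)
    have hmono := hanti hs.1 ht hs.2.le
    have hbound : m s - 2 * (ε / 3) ≤ m t := by
      refine hge ht0 fun u hu hut => ?_
      rcases le_or_gt u s with hus | hsu
      · linarith [hle hu hus]
      have hms := hle hs.1 le_rfl
      rcases hut.eq_or_lt with rfl | hut
      · linarith [hfs.2]
      have hdist : dist u t < δ := by
        rw [Real.dist_eq, abs_lt] at hst ⊢
        constructor <;> linarith [hst.1]
      have hfu := abs_lt.1 (h ⟨hu, hut⟩ hdist)
      linarith [hfs.2, hfu.1]
    rw [Real.dist_eq, abs_lt]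
    constructor <;> linarith
  · refine Metric.continuousWithinAt_iff.2 fun ε hε => ?_
    obtain ⟨δ, hδ, h⟩ := Metric.continuousWithinAt_iff.1 (hrc t ht) (ε / 2) (by positivity)
    refine ⟨δ, hδ, fun s hs hst => ?_⟩
    have hts : t ≤ s := hs
    have hmono := hanti ht (ht0.trans hts) hts
    have hbound : m t - ε / 2 ≤ m s := by
      refine hge (ht0.trans hts) fun u hu hus => ?_
      rcases le_or_gt u t with hut | htu
      · linarith [hle hu hut]
      have hdist : dist u t < δ := by
        rw [Real.dist_eq, abs_lt] at hst ⊢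
        constructor <;> linarith [hst.2]
      have hfu := abs_lt.1 (h htu.le hdist)
      linarith [hfu.1, hle ht0 (le_refl t)]
    rw [Real.dist_eq, abs_lt]
    constructor <;> linarith
end
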